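/- arXiv:1905.00791 — 2 statements merged into one kernel-verified Lean document; each statement's English description precedes it below -/
import Mathlib

section
/- Every perfect bichromatic matching M on a set P of n ≥ 4 points in the plane in convex position (and in general position), consisting of n/2 red and n/2 blue points, can be transformed by at most two flips into a perfect bichromatic matching that contains a boundary edge, i.e., an edge {p,q} such that all points of P \ {p,q} lie strictly on one side of the line through p and q. -/
open EuclideanGeometry Real

noncomputable section

/-- Points of the Euclidean plane. -/
abbrev Pt : Type := EuclideanSpace ℝ (Fin 2)

/-- Two closed segments `ab` and `cd` on four distinct points *cross* if their open
segments have a common point. -/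
def SegCross (a b c d : Pt) : Prop :=
  a ≠ b ∧ a ≠ c ∧ a ≠ d ∧ b ≠ c ∧ b ≠ d ∧ c ≠ d ∧
    (openSegment ℝ a b ∩ openSegment ℝ c d).Nonempty

/-- No three distinct points of `P` are collinear. -/
def GenPos (P : Set Pt) : Prop :=
  ∀ p ∈ P, ∀ q ∈ P, ∀ r ∈ P, p ≠ q → p ≠ r → q ≠ r →
    ¬ Collinear ℝ ({p, q, r} : Set Pt)

/-- `P` is in convex position: no point lies in the convex hull of the others. -/
def ConvexPos (P : Set Pt) : Prop :=
  ∀ p ∈ P, p ∉ convexHull ℝ (P \ {p})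

/-- `M` is a perfect bichromatic matching between the red points `R` and the blue
points `B`: a set of (red, blue) pairs such that every red point is the red endpoint of
exactly one edge and every blue point is the blue endpoint of exactly one edge. -/
def IsBiPM (R B : Finset Pt) (M : Set (Pt × Pt)) : Prop :=
  (∀ e ∈ M, e.1 ∈ R ∧ e.2 ∈ B) ∧
  (∀ r ∈ R, ∃! e, e ∈ M ∧ e.1 = r) ∧
  (∀ b ∈ B, ∃! e, e ∈ M ∧ e.2 = b)

/-- A bichromatic matching is plane if no two of its edges cross. -/
def BiPlane (M : Set (Pt × Pt)) : Prop :=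
  ∀ e ∈ M, ∀ f ∈ M, ¬ SegCross e.1 e.2 f.1 f.2

/-- `M'` is obtained from `M` by a single bichromatic flip: two crossing edges
`{r,b}`, `{r',b'}` are replaced by `{r,b'}`, `{r',b}`. -/
def BiFlip (M M' : Set (Pt × Pt)) : Prop :=
  ∃ r b r' b' : Pt, (r, b) ∈ M ∧ (r', b') ∈ M ∧ SegCross r b r' b' ∧
    M' = (M \ {(r, b), (r', b')}) ∪ {(r, b'), (r', b)}

/-- `M` can be transformed into a plane bichromatic matching by at most `k` flips. -/
def BiFlipsToPlane (M : Set (Pt × Pt)) (k : ℕ) : Prop :=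
  ∃ (j : ℕ) (g : ℕ → Set (Pt × Pt)), j ≤ k ∧ g 0 = M ∧
    (∀ i < j, BiFlip (g i) (g (i + 1))) ∧ BiPlane (g j)

/-- `{p, q}` is a boundary edge of `P`: all other points of `P` lie strictly on one
side of the line through `p` and `q`. -/
def BoundaryEdge (P : Set Pt) (p q : Pt) : Prop :=
  p ≠ q ∧ ∀ x ∈ P \ {p, q}, ∀ y ∈ P \ {p, q},
    (affineSpan ℝ ({p, q} : Set Pt)).SSameSide x y

/-- Orientation determinant. -/
def odet (a b c : Pt) : ℝ :=
  (b 0 - a 0) * (c 1 - a 1) - (b 1 - a 1) * (c 0 - a 0)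

lemma pt_ext {x y : Pt} (h0 : x 0 = y 0) (h1 : x 1 = y 1) : x = y := by
  ext i
  fin_cases i
  · exact h0
  · exact h1

lemma odet_collinear {a b c : Pt} (hab : a ≠ b) (h : odet a b c = 0) :
    Collinear ℝ ({a, b, c} : Set Pt) := by
  rw [collinear_iff_of_mem (p₀ := a) (by simp)]
  refine ⟨b - a, ?_⟩
  intro p hp
  simp only [Set.mem_insert_iff, Set.mem_singleton_iff] at hp
  rcases hp with rfl | rfl | rfl
  · exact ⟨0, by simp⟩
  · exact ⟨1, by simp⟩
  · unfold odet at h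
    by_cases h0 : b 0 - a 0 = 0
    · have h1 : b 1 - a 1 ≠ 0 := by
        intro h1
        exact hab (pt_ext (by linarith) (by linarith))
      refine ⟨(p 1 - a 1) / (b 1 - a 1), pt_ext ?_ ?_⟩
      · simp only [vadd_eq_add, PiLp.add_apply, PiLp.smul_apply, PiLp.sub_apply, smul_eq_mul]
        field_simp
        linarith
      · simp only [vadd_eq_add, PiLp.add_apply, PiLp.smul_apply, PiLp.sub_apply, smul_eq_mul]
        field_simp
        linarith
    · refine ⟨(p 0 - a 0) / (b 0 - a 0), pt_ext ?_ ?_⟩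
      · simp only [vadd_eq_add, PiLp.add_apply, PiLp.smul_apply, PiLp.sub_apply, smul_eq_mul]
        field_simp
        linarith
      · simp only [vadd_eq_add, PiLp.add_apply, PiLp.smul_apply, PiLp.sub_apply, smul_eq_mul]
        field_simp
        linarith

lemma odet_ne {a b c : Pt} (h : 0 < odet a b c) : a ≠ b ∧ a ≠ c ∧ b ≠ c := by
  refine ⟨?_, ?_, ?_⟩ <;> rintro rfl <;> unfold odet at h <;> nlinarith

lemma odet_trans {P : Set Pt} (hcv : ConvexPos P) {a b c d : Pt} (ha : a ∈ P) (hb : b ∈ P)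
    (hc : c ∈ P) (hd : d ∈ P) (h1 : 0 < odet a b c) (h2 : 0 < odet a c d) :
    0 < odet a b d := by
  by_contra h
  push Not at h
  obtain ⟨hab, hac, -⟩ := odet_ne h1
  obtain ⟨-, had, -⟩ := odet_ne h2
  apply hcv a ha
  have mem : ∀ x ∈ P, a ≠ x → x ∈ convexHull ℝ (P \ {a}) := fun x hx hne =>
    subset_convexHull ℝ _ ⟨hx, fun h => hne h.symm⟩
  have hconv := convex_convexHull ℝ (P \ {a})
  have hS : 0 < odet a c d + (- odet a b d) + odet a b c := by linarith
  have key := hconv.sum_mem (t := (Finset.univ : Finset (Fin 3)))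
    (w := ![odet a c d / (odet a c d + (- odet a b d) + odet a b c),
      (- odet a b d) / (odet a c d + (- odet a b d) + odet a b c),
      odet a b c / (odet a c d + (- odet a b d) + odet a b c)]) (z := ![b, c, d])
    (by
      intro i _
      fin_cases i
      · exact div_nonneg h2.le hS.le
      · exact div_nonneg (by linarith) hS.le
      · exact div_nonneg h1.le hS.le)
    (by
      simp only [Fin.sum_univ_three, Matrix.cons_val_zero, Matrix.cons_val_one, Matrix.cons_val]
      field_simp)
    (by
      intro i _
      fin_cases i
      · exact mem b hb hab
      · exact mem c hc hac
      · exact mem d hd had)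
  simp only [Fin.sum_univ_three, Matrix.cons_val_zero, Matrix.cons_val_one, Matrix.cons_val] at key
  convert key using 1
  apply pt_ext <;>
  · simp only [PiLp.add_apply, PiLp.smul_apply, smul_eq_mul]
    field_simp
    unfold odet
    ring

lemma odet_cyc (a b c : Pt) : odet b c a = odet a b c := by unfold odet; ring
lemma odet_swap (a b c : Pt) : odet c b a = - odet a b c := by unfold odet; ring

lemma seg_cross {a b c d : Pt} (hab : a ≠ b) (hcd : c ≠ d)
    (h1 : 0 < odet a c b) (h2 : 0 < odet b d a)
    (h3 : 0 < odet a c d) (h4 : 0 < odet b d c) : SegCross a b c d := by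
  obtain ⟨hac, -, hcb⟩ := odet_ne h1
  obtain ⟨hbd, -, hda⟩ := odet_ne h2
  refine ⟨hab, hac, hda.symm, hcb.symm, hbd, hcd, ?_⟩
  have e1 : 0 < odet a c d + odet b d c := by linarith
  have e2 : odet a c d + odet b d c = odet a c b + odet b d a := by unfold odet; ring
  have e3 : 0 < odet a c b + odet b d a := by linarith
  refine ⟨(odet b d c / (odet a c d + odet b d c)) • a +
    (odet a c d / (odet a c d + odet b d c)) • b, ?_, ?_⟩
  · exact ⟨_, _, div_pos h4 e1, div_pos h3 e1, by field_simp; ring, rfl⟩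
  · refine ⟨odet b d a / (odet a c b + odet b d a), odet a c b / (odet a c b + odet b d a),
      div_pos h2 e3, div_pos h1 e3, by field_simp; ring, ?_⟩
    rw [← e2]
    apply pt_ext <;>
    · simp only [PiLp.add_apply, PiLp.smul_apply, smul_eq_mul]
      field_simp
      unfold odet
      ring

lemma seg_cross_symm {a b c d : Pt} (h : SegCross a b c d) : SegCross a b d c := by
  obtain ⟨h1, h2, h3, h4, h5, h6, h7⟩ := h
  exact ⟨h1, h3, h2, h5, h4, h6.symm, by rwa [openSegment_symm ℝ d c]⟩

lemma seg_cross_symm' {a b c d : Pt} (h : SegCross a b c d) : SegCross b a c d := by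
  obtain ⟨h1, h2, h3, h4, h5, h6, h7⟩ := h
  exact ⟨h1.symm, h4, h5, h2, h3, h6, by rwa [openSegment_symm ℝ b a]⟩

lemma odet_not_mem {p q x : Pt} (h : odet p q x ≠ 0) :
    x ∉ affineSpan ℝ ({p, q} : Set Pt) := by
  intro hx
  obtain ⟨t, rfl⟩ := (mem_affineSpan_pair_iff_exists_lineMap_eq).1 hx
  apply h
  unfold odet
  simp [AffineMap.lineMap_apply]
  ring

lemma odet_sameSide {p q x y : Pt} (h : 0 < odet p q x * odet p q y) :
    (affineSpan ℝ ({p, q} : Set Pt)).SSameSide x y := by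
  have hx : odet p q x ≠ 0 := fun h0 => by simp [h0] at h
  have hy : odet p q y ≠ 0 := fun h0 => by simp [h0] at h
  refine ⟨?_, odet_not_mem hx, odet_not_mem hy⟩
  refine ⟨p, left_mem_affineSpan_pair ℝ p q,
    AffineMap.lineMap p q (odet p y x / odet p q x),
    AffineMap.lineMap_mem_affineSpan_pair _ _ _, ?_⟩
  have : y -ᵥ AffineMap.lineMap p q (odet p y x / odet p q x)
      = (odet p q y / odet p q x) • (x -ᵥ p) := by
    apply pt_ext <;>
    · simp only [AffineMap.lineMap_apply, vsub_eq_sub, vadd_eq_add, PiLp.add_apply,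
        PiLp.smul_apply, PiLp.sub_apply, smul_eq_mul]
      field_simp
      unfold odet
      ring
  rw [this]
  apply SameRay.sameRay_nonneg_smul_right
  rw [← mul_div_mul_left _ _ hx]
  exact div_nonneg h.le (mul_self_nonneg _)

/-- Open arc of `P` from `x` to `y`. -/
def arc (C : Pt → Pt → Pt → Prop) (P : Set Pt) (x y : Pt) : Set Pt := {z | z ∈ P ∧ C x z y}

/-- The properties of the cyclic order of points in convex position used below. -/
structure CycOrd (C : Pt → Pt → Pt → Prop) (P : Set Pt) : Prop where
  cyc : ∀ a b c, C a b c → C b c a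
  asym : ∀ a b c, C a b c → ¬ C c b a
  total : ∀ a ∈ P, ∀ b ∈ P, ∀ c ∈ P, a ≠ b → a ≠ c → b ≠ c → C a b c ∨ C c b a
  trans : ∀ a ∈ P, ∀ b ∈ P, ∀ c ∈ P, ∀ d ∈ P, C a b c → C a c d → C a b d
  cross : ∀ a ∈ P, ∀ b ∈ P, ∀ c ∈ P, ∀ d ∈ P, C a c b → C b d a →
    SegCross a b c d
  bdry : ∀ x ∈ P, ∀ y ∈ P, x ≠ y → (∀ z ∈ P, ¬ C x z y) → BoundaryEdge P x y

lemma boundaryEdge_symm {P : Set Pt} {x y : Pt} (h : BoundaryEdge P x y) :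
    BoundaryEdge P y x := by
  unfold BoundaryEdge at *
  rw [Set.pair_comm y x]
  exact ⟨h.1.symm, h.2⟩

lemma CycOrd.rev {C : Pt → Pt → Pt → Prop} {P : Set Pt} (h : CycOrd C P) :
    CycOrd (fun a b c => C c b a) P where
  cyc a b c k := h.cyc _ _ _ (h.cyc _ _ _ k)
  asym a b c k := h.asym _ _ _ k
  total a ha b hb c hc h1 h2 h3 := (h.total a ha b hb c hc h1 h2 h3).symm
  trans a ha b hb c hc d hd k1 k2 := by
    have k1' := h.cyc _ _ _ (h.cyc _ _ _ k1)
    have k2' := h.cyc _ _ _ (h.cyc _ _ _ k2)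
    exact h.cyc _ _ _ (h.trans a ha d hd c hc b hb k2' k1')
  cross a ha b hb c hc d hd k1 k2 :=
    seg_cross_symm (h.cross a ha b hb d hd c hc k2 k1)
  bdry x hx y hy hne k := boundaryEdge_symm (h.bdry y hy x hx hne.symm k)

lemma cycOrd_odet {P : Set Pt} (hgp : GenPos P) (hcv : ConvexPos P) :
    CycOrd (fun a b c => 0 < odet a b c) P where
  cyc a b c k := by rwa [odet_cyc]
  asym a b c k := by rw [odet_swap]; linarith
  total a ha b hb c hc h1 h2 h3 := by
    rw [odet_swap a b c]
    rcases lt_trichotomy (odet a b c) 0 with h | h | h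
    · right; linarith
    · exact absurd (odet_collinear h1 h) (hgp a ha b hb c hc h1 h2 h3)
    · left; exact h
  trans a ha b hb c hc d hd k1 k2 := odet_trans hcv ha hb hc hd k1 k2
  cross a ha b hb c hc d hd k1 k2 := by
    have h3 : 0 < odet a c d := odet_trans hcv ha hc hb hd k1 (by rwa [← odet_cyc a b d] )
    have h4 : 0 < odet b d c := odet_trans hcv hb hd ha hc k2 (by rwa [← odet_cyc b a c])
    exact seg_cross (odet_ne k1).2.1 (odet_ne h3).2.2 k1 k2 h3 h4
  bdry x hx y hy hne k := by
    have pos : ∀ z ∈ P \ {x, y}, 0 < odet x y z := by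
      intro z hz
      obtain ⟨hz, hn⟩ := hz
      simp only [Set.mem_insert_iff, Set.mem_singleton_iff, not_or] at hn
      have h1 := k z hz
      have e : odet x z y = - odet x y z := by unfold odet; ring
      rw [e] at h1
      rcases lt_trichotomy (odet x y z) 0 with h | h | h
      · exact absurd (by linarith) h1
      · exact absurd (odet_collinear hne h)
          (hgp x hx y hy z hz hne (Ne.symm hn.1) (Ne.symm hn.2))
      · exact h
    exact ⟨hne, fun u hu v hv => odet_sameSide (mul_pos (pos u hu) (pos v hv))⟩

/-- `M` reaches a matching with a boundary edge in at most two flips. -/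
def Reach (P : Set Pt) (M : Set (Pt × Pt)) : Prop :=
  ∃ (j : ℕ) (g : ℕ → Set (Pt × Pt)), j ≤ 2 ∧ g 0 = M ∧
      (∀ i < j, BiFlip (g i) (g (i + 1))) ∧
      ∃ e ∈ g j, BoundaryEdge P e.1 e.2

lemma reach0 {P : Set Pt} {M : Set (Pt × Pt)} {x y : Pt} (h : (x, y) ∈ M)
    (hb : BoundaryEdge P x y) : Reach P M :=
  ⟨0, fun _ => M, by norm_num, rfl, by simp, (x, y), h, hb⟩

lemma reach1 {P : Set Pt} {M M1 : Set (Pt × Pt)} {x y : Pt} (hf : BiFlip M M1)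
    (h : (x, y) ∈ M1) (hb : BoundaryEdge P x y) : Reach P M := by
  refine ⟨1, fun i => if i = 0 then M else M1, by norm_num, rfl, ?_, (x, y), by simpa using h, hb⟩
  intro i hi
  obtain rfl : i = 0 := by omega
  simpa using hf

lemma reach2 {P : Set Pt} {M M1 M2 : Set (Pt × Pt)} {x y : Pt} (hf : BiFlip M M1)
    (hf2 : BiFlip M1 M2)
    (h : (x, y) ∈ M2) (hb : BoundaryEdge P x y) : Reach P M := by
  refine ⟨2, fun i => if i = 0 then M else if i = 1 then M1 else M2, le_rfl, rfl, ?_,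
    (x, y), by simpa using h, hb⟩
  intro i hi
  obtain rfl | rfl : i = 0 ∨ i = 1 := by omega
  · simpa using hf
  · simpa using hf2

lemma CycOrd.ne {C : Pt → Pt → Pt → Prop} {P : Set Pt} (h : CycOrd C P) {a b c : Pt}
    (k : C a b c) : a ≠ b ∧ a ≠ c ∧ b ≠ c := by
  have k1 := h.cyc _ _ _ k
  have k2 := h.cyc _ _ _ k1
  refine ⟨?_, ?_, ?_⟩
  · rintro rfl; exact h.asym _ _ _ k1 k1
  · rintro rfl; exact h.asym _ _ _ k k
  · rintro rfl; exact h.asym _ _ _ k2 k2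

/-- Subarcs: if `r, x, y` lie in this order then the arc from `x` to `y` is smaller. -/
lemma CycOrd.arc_right {C : Pt → Pt → Pt → Prop} {P : Set Pt} (h : CycOrd C P)
    (hfin : P.Finite) {r x y : Pt} (hr : r ∈ P) (hx : x ∈ P) (hy : y ∈ P) (k : C r x y) :
    arc C P x y ⊂ arc C P r y := by
  rw [Set.ssubset_iff_of_subset]
  · exact ⟨x, ⟨hx, k⟩, fun hh => (h.ne hh.2).1 rfl⟩
  · rintro z ⟨hz, kz⟩
    have k1 : C y r x := h.cyc _ _ _ (h.cyc _ _ _ k)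
    have k2 : C y x z := h.cyc _ _ _ (h.cyc _ _ _ kz)
    exact ⟨hz, h.cyc _ _ _ (h.trans y hy r hr x hx z hz k1 k2)⟩

lemma CycOrd.arc_left {C : Pt → Pt → Pt → Prop} {P : Set Pt} (h : CycOrd C P)
    (hfin : P.Finite) {r y b : Pt} (hr : r ∈ P) (hy : y ∈ P) (hb : b ∈ P) (k : C r y b) :
    arc C P r y ⊂ arc C P r b := by
  rw [Set.ssubset_iff_of_subset]
  · exact ⟨y, ⟨hy, k⟩, fun hh => (h.ne hh.2).2.2 rfl⟩
  · rintro z ⟨hz, kz⟩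
    exact ⟨hz, h.trans r hr z hz y hy b hb kz k⟩

lemma core {C : Pt → Pt → Pt → Prop} {R B : Finset Pt} (hdisj : Disjoint R B)
    (h : CycOrd C (↑R ∪ ↑B)) {M : Set (Pt × Pt)} (hM : IsBiPM R B M) {r b : Pt}
    (hrb : (r, b) ∈ M)
    (hmin : ∀ e ∈ M, (arc C (↑R ∪ ↑B) r b).ncard ≤ (arc C (↑R ∪ ↑B) e.1 e.2).ncard ∧
      (arc C (↑R ∪ ↑B) r b).ncard ≤ (arc C (↑R ∪ ↑B) e.2 e.1).ncard) :
    Reach (↑R ∪ ↑B) M := by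
  set P : Set Pt := ↑R ∪ ↑B with hP
  have hfin : P.Finite := (R.finite_toSet.union B.finite_toSet)
  have afin : ∀ x y, (arc C P x y).Finite := fun x y => hfin.subset fun z hz => hz.1
  have inR : ∀ x ∈ R, x ∈ P := fun x hx => Or.inl hx
  have inB : ∀ x ∈ B, x ∈ P := fun x hx => Or.inr hx
  have hneRB : ∀ x ∈ R, ∀ y ∈ B, x ≠ y := fun x hx y hy e =>
    Finset.disjoint_left.1 hdisj hx (e ▸ hy)
  obtain ⟨hM1, hM2, hM3⟩ := hM
  have hrR := (hM1 _ hrb).1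
  have hbB := (hM1 _ hrb).2
  simp only at hrR hbB
  have hr := inR r hrR
  have hb := inB b hbB
  have uniqR : ∀ x y y', (x, y) ∈ M → (x, y') ∈ M → y = y' := fun x y y' k k' =>
    congrArg Prod.snd ((hM2 x (hM1 _ k).1).unique ⟨k, rfl⟩ ⟨k', rfl⟩)
  have uniqB : ∀ x x' y, (x, y) ∈ M → (x', y) ∈ M → x = x' := fun x x' y k k' =>
    congrArg Prod.fst ((hM3 y (hM1 _ k).2).unique ⟨k, rfl⟩ ⟨k', rfl⟩)
  have inside : ∀ u ∈ P, ∀ v ∈ P, C r u v → C r v b →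
      (arc C P u v).ncard < (arc C P r b).ncard := by
    intro u hu v hv k1 k2
    exact (Set.ncard_lt_ncard (h.arc_right hfin hr hu hv k1) (afin _ _)).trans
      (Set.ncard_lt_ncard (h.arc_left hfin hr hv hb k2) (afin _ _))
  have noedge : ∀ x y, (x, y) ∈ M → C r x b → C r y b → False := by
    intro x y k k1 k2
    have hxR := (hM1 _ k).1
    have hyB := (hM1 _ k).2
    have hx := inR x hxR
    have hy := inB y hyB
    rcases h.total r hr x hx y hy (h.ne k1).1 (h.ne k2).1 (hneRB x hxR y hyB) with t | t
    · exact absurd (inside x hx y hy t k2) (not_lt.2 (hmin _ k).1)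
    · exact absurd (inside y hy x hx (h.cyc _ _ _ (h.cyc _ _ _ t)) k1) (not_lt.2 (hmin _ k).2)
  have partR : ∀ x ∈ R, C r x b → ∃ y, (x, y) ∈ M ∧ y ∈ B ∧ C b y r := by
    intro x hx k
    obtain ⟨⟨x', y⟩, ⟨hm, rfl⟩, -⟩ := hM2 x hx
    have hyB := (hM1 _ hm).2
    refine ⟨y, hm, hyB, ?_⟩
    have hyb : y ≠ b := by
      rintro rfl
      exact (h.ne k).1 (uniqB _ _ _ hrb hm)
    rcases h.total r hr y (inB y hyB) b hb (hneRB r hrR y hyB) (h.ne k).2.1 hyb with t | t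
    · exact (noedge _ _ hm k t).elim
    · exact t
  have partB : ∀ y ∈ B, C r y b → ∃ x, (x, y) ∈ M ∧ x ∈ R ∧ C b x r := by
    intro y hy k
    obtain ⟨⟨x, y'⟩, ⟨hm, rfl⟩, -⟩ := hM3 y hy
    have hxR := (hM1 _ hm).1
    refine ⟨x, hm, hxR, ?_⟩
    have hxr : r ≠ x := by
      rintro rfl
      exact (h.ne k).2.2 (uniqR _ _ _ hm hrb)
    rcases h.total r hr x (inR x hxR) b hb hxr (h.ne k).2.1 (hneRB x hxR b hbB) with t | t
    · exact (noedge _ _ hm t k).elim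
    · exact t
  obtain ⟨y, ⟨hyB, hyb⟩, hymin⟩ := WellFounded.has_min
    (InvImage.wf (fun y => (arc C P r y).ncard) (Nat.lt_wfRel.wf))
    {y | y ∈ B ∧ (y = b ∨ C r y b)} ⟨b, hbB, Or.inl rfl⟩
  have hy := inB y hyB
  have allred : ∀ z ∈ arc C P r y, z ∈ R := by
    rintro z ⟨hz, kz⟩
    rcases hz with hz | hz
    · exact hz
    · exfalso
      refine hymin z ⟨hz, Or.inr ?_⟩
        (Set.ncard_lt_ncard (h.arc_left hfin hr (inB z hz) hy kz) (afin _ _))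
      rcases hyb with rfl | k
      · exact kz
      · exact h.trans r hr z (inB z hz) y hy b hb kz k
  by_cases hemp : arc C P r y = ∅
  · have bd : BoundaryEdge P r y := h.bdry r hr y hy (hneRB r hrR y hyB) fun z hz k => by
      have : z ∈ arc C P r y := ⟨hz, k⟩
      rw [hemp] at this
      exact this
    rcases hyb with rfl | k
    · exact reach0 hrb bd
    · obtain ⟨r', hm, hrR2, k'⟩ := partB y hyB k
      refine reach1 ⟨r, b, r', y, hrb, hm, ?_, rfl⟩ (x := r) (y := y) (by simp) bd
      exact seg_cross_symm (h.cross r hr b hb y hy r' (inR _ hrR2) k k')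
  · obtain ⟨x, hx', hxmin⟩ := WellFounded.has_min
      (InvImage.wf (fun x => (arc C P x y).ncard) (Nat.lt_wfRel.wf))
      (arc C P r y) (Set.nonempty_iff_ne_empty.2 hemp)
    have hxR := allred x hx'
    obtain ⟨hx, kx⟩ := hx'
    have bd : BoundaryEdge P x y := h.bdry x hx y hy (hneRB x hxR y hyB) fun z hz k =>
      hxmin z ((h.arc_right hfin hr hx hy kx).1 ⟨hz, k⟩)
        (Set.ncard_lt_ncard (h.arc_right hfin hx hz hy k) (afin _ _))
    rcases hyb with rfl | k
    · obtain ⟨b', hm, hbB2, k'⟩ := partR x hxR kx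
      exact reach1 ⟨r, y, x, b', hrb, hm, h.cross r hr y hy x hx b' (inB _ hbB2) kx k', rfl⟩
        (x := x) (y := y) (by simp) bd
    · have kxb : C r x b := h.trans r hr x hx y hy b hb kx k
      obtain ⟨b', hm, hbB2, k'⟩ := partR x hxR kxb
      obtain ⟨r', hm', hrR2, k''⟩ := partB y hyB k
      have c1 : C x y b := by
        have k1 : C y b r := h.cyc _ _ _ k
        have k2 : C y r x := h.cyc _ _ _ (h.cyc _ _ _ kx)
        exact h.cyc _ _ _ (h.cyc _ _ _ (h.trans y hy b hb r hr x hx k1 k2))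
      have c2 : C b r' x := h.trans b hb r' (inR _ hrR2) r hr x hx k''
        (h.cyc _ _ _ (h.cyc _ _ _ kxb))
      refine reach2 ⟨r, b, x, b', hrb, hm, h.cross r hr b hb x hx b' (inB _ hbB2) kxb k', rfl⟩
        ⟨x, b, r', y, ?_, ?_,
          seg_cross_symm (h.cross x hx b hb y hy r' (inR _ hrR2) c1 c2), rfl⟩
        (x := x) (y := y) (by simp) bd
      · simp
      · left
        refine ⟨hm', ?_⟩
        have n1 : r' ≠ r := (h.ne k'').2.2
        have n2 : r' ≠ x := (h.ne c2).2.2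
        simp [n1, n2]

/-- Every perfect bichromatic matching on `n ≥ 4` points (`n/2` red,
`n/2` blue) in convex (and general) position can be transformed, by at most two flips,
into a perfect bichromatic matching containing a boundary edge. -/
theorem stmt16 (n : ℕ) (hn : Even n) (h4 : 4 ≤ n) (R B : Finset Pt)
    (hR : R.card = n / 2) (hB : B.card = n / 2) (hdisj : Disjoint R B)
    (hgp : GenPos (↑R ∪ ↑B)) (hcv : ConvexPos (↑R ∪ ↑B))
    (M : Set (Pt × Pt)) (hM : IsBiPM R B M) :
    ∃ (j : ℕ) (g : ℕ → Set (Pt × Pt)), j ≤ 2 ∧ g 0 = M ∧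
      (∀ i < j, BiFlip (g i) (g (i + 1))) ∧
      ∃ e ∈ g j, BoundaryEdge (↑R ∪ ↑B) e.1 e.2 := by
  have h := cycOrd_odet hgp hcv
  have hne : R.Nonempty := by
    rw [← Finset.card_pos]
    omega
  obtain ⟨r0, hr0⟩ := hne
  obtain ⟨e0, ⟨he0, -⟩, -⟩ := hM.2.1 r0 hr0
  obtain ⟨e, he, hmin⟩ := WellFounded.has_min
    (InvImage.wf (fun e : Pt × Pt => min
      (arc (fun a b c => 0 < odet a b c) (↑R ∪ ↑B) e.1 e.2).ncard
      (arc (fun a b c => 0 < odet a b c) (↑R ∪ ↑B) e.2 e.1).ncard) (Nat.lt_wfRel.wf))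
    M ⟨e0, he0⟩
  have hmin' : ∀ f ∈ M, min
      (arc (fun a b c => 0 < odet a b c) (↑R ∪ ↑B) e.1 e.2).ncard
      (arc (fun a b c => 0 < odet a b c) (↑R ∪ ↑B) e.2 e.1).ncard ≤ min
      (arc (fun a b c => 0 < odet a b c) (↑R ∪ ↑B) f.1 f.2).ncard
      (arc (fun a b c => 0 < odet a b c) (↑R ∪ ↑B) f.2 f.1).ncard :=
    fun f hf => not_lt.1 (hmin f hf)
  rcases le_total (arc (fun a b c => 0 < odet a b c) (↑R ∪ ↑B) e.1 e.2).ncard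
      (arc (fun a b c => 0 < odet a b c) (↑R ∪ ↑B) e.2 e.1).ncard with hle | hle
  · refine core hdisj h hM (r := e.1) (b := e.2) he fun f hf => ?_
    have := hmin' f hf
    rw [min_eq_left hle] at this
    exact le_min_iff.1 this
  · refine core hdisj h.rev hM (r := e.1) (b := e.2) he fun f hf => ?_
    have := hmin' f hf
    rw [min_eq_right hle] at this
    exact (le_min_iff.1 this).symm
end
end

section
/- Let P be a set of n points in the plane consisting of n/2 blue points lying on a line ℓ and n/2 red points not on ℓ, with no three points of P collinear except blue points on ℓ. Then every perfect bichromatic matching M on P can be transformed into a plane perfect bichromatic matching by at most n²/4 − n/2 flips; that is, f(M) ≤ n²/4 − n/2. -/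
open EuclideanGeometry Real

noncomputable section

/-! ### Abstract swap sequences -/

/-- `Steps ok j σ τ`: `τ` is obtained from `σ` by `j` admissible swaps. -/
inductive Steps {α β : Type*} [DecidableEq α] (ok : (α → β) → α → α → Prop) :
    ℕ → (α → β) → (α → β) → Prop
  | refl (σ : α → β) : Steps ok 0 σ σ
  | head {j : ℕ} {σ τ : α → β} (x y : α) (h : ok σ x y)
      (t : Steps ok j (σ ∘ Equiv.swap x y) τ) : Steps ok (j + 1) σ τ

theorem Steps.trans {α β : Type*} [DecidableEq α] {ok : (α → β) → α → α → Prop}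
    {i j : ℕ} {σ τ ρ : α → β} (h : Steps ok i σ τ) (h' : Steps ok j τ ρ) :
    Steps ok (i + j) σ ρ := by
  induction h with
  | refl => simpa using h'
  | @head k σ τ x y hxy t ih =>
    have := Steps.head x y hxy (ih h')
    convert this using 1
    omega

theorem Steps.mono {α β : Type*} [DecidableEq α] {ok ok' : (α → β) → α → α → Prop}
    (hok : ∀ σ x y, ok σ x y → ok' σ x y)
    {i : ℕ} {σ τ : α → β} (h : Steps ok i σ τ) : Steps ok' i σ τ := by
  induction h with
  | refl => exact Steps.refl _
  | head x y hxy t ih => exact Steps.head x y (hok _ _ _ hxy) ih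

/-! ### The token game -/

/-- A token `q` and the hole `r` may be exchanged. -/
def TokOk {α : Type*} (S : Finset α) (r : α) (g : α → ℕ) (P : α → ℕ) (x y : α) : Prop :=
  x = r ∧ y ∈ S ∧ y ≠ r ∧ ((P y < P r ∧ P r < g y) ∨ (g y ≤ P r ∧ P r < P y))

def LBar {α : Type*} (S : Finset α) (r : α) (g : α → ℕ) (lo : ℕ) (P : α → ℕ) : Prop :=
  lo ≤ P r ∧ ∀ q ∈ S, q ≠ r → P q < lo → g q ≤ lo

def RBar {α : Type*} (S : Finset α) (r : α) (g : α → ℕ) (hi : ℕ) (P : α → ℕ) : Prop :=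
  P r ≤ hi ∧ ∀ q ∈ S, q ≠ r → hi < P q → hi < g q

theorem swap_hole {α : Type*} [DecidableEq α] (P : α → ℕ) (r y : α) :
    (P ∘ Equiv.swap r y) r = P y := by simp

theorem swap_tok {α : Type*} [DecidableEq α] (P : α → ℕ) (r y : α) :
    (P ∘ Equiv.swap r y) y = P r := by simp

theorem swap_other {α : Type*} [DecidableEq α] (P : α → ℕ) {r y q : α} (h : q ≠ r) (h' : q ≠ y) :
    (P ∘ Equiv.swap r y) q = P q := by simp [Equiv.swap_apply_of_ne_of_ne h h']

theorem LBar.move {α : Type*} [DecidableEq α] {S : Finset α} {r : α} {g : α → ℕ} {lo : ℕ}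
    {P : α → ℕ} (h : LBar S r g lo P) {y : α} (hy : TokOk S r g P r y) :
    LBar S r g lo (P ∘ Equiv.swap r y) := by
  obtain ⟨h1, h2⟩ := h
  obtain ⟨-, hyS, hyr, hc⟩ := hy
  have hy2 := h2 y hyS hyr
  refine ⟨?_, ?_⟩
  · rw [swap_hole]; omega
  · intro q hq hqr
    by_cases hqy : q = y
    · subst hqy; rw [swap_tok]; omega
    · rw [swap_other P hqr hqy]; exact h2 q hq hqr

theorem RBar.move {α : Type*} [DecidableEq α] {S : Finset α} {r : α} {g : α → ℕ} {hi : ℕ}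
    {P : α → ℕ} (h : RBar S r g hi P) {y : α} (hy : TokOk S r g P r y) :
    RBar S r g hi (P ∘ Equiv.swap r y) := by
  obtain ⟨h1, h2⟩ := h
  obtain ⟨-, hyS, hyr, hc⟩ := hy
  have hy2 := h2 y hyS hyr
  refine ⟨?_, ?_⟩
  · rw [swap_hole]; omega
  · intro q hq hqr
    by_cases hqy : q = y
    · subst hqy; rw [swap_tok]; omega
    · rw [swap_other P hqr hqy]; exact h2 q hq hqr

/-- Move the hole left as long as possible. -/
theorem sweepL {α : Type*} [DecidableEq α] (S : Finset α) (r : α) (g : α → ℕ) :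
    ∀ (m : ℕ) (P : α → ℕ), P r ≤ m → ∃ j P', Steps (TokOk S r g) j P P' ∧ P' r + j ≤ P r ∧
      LBar S r g (P' r) P' ∧ (∀ lo, LBar S r g lo P → LBar S r g lo P') ∧
      (∀ hi, RBar S r g hi P → RBar S r g hi P') := by
  intro m
  induction m with
  | zero =>
    intro P hP
    exact ⟨0, P, Steps.refl _, by omega, ⟨le_rfl, fun q _ _ h => by omega⟩, fun _ h => h,
      fun _ h => h⟩
  | succ m ih =>
    intro P hP
    by_cases hc : ∃ y ∈ S, y ≠ r ∧ P y < P r ∧ P r < g y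
    · obtain ⟨y, hyS, hyr, h1, h2⟩ := hc
      have hok : TokOk S r g P r y := ⟨rfl, hyS, hyr, Or.inl ⟨h1, h2⟩⟩
      obtain ⟨j, P', hs, hj, hL, hl, hr⟩ := ih (P ∘ Equiv.swap r y) (by rw [swap_hole]; omega)
      rw [swap_hole] at hj
      exact ⟨j + 1, P', Steps.head r y hok hs, by omega, hL, fun lo h => hl lo (h.move hok),
        fun hi h => hr hi (h.move hok)⟩
    · push Not at hc
      exact ⟨0, P, Steps.refl _, by omega, ⟨le_rfl, fun q hq hqr h => hc q hq hqr h⟩,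
        fun _ h => h, fun _ h => h⟩

/-- Move the hole right as long as possible. -/
theorem sweepR {α : Type*} [DecidableEq α] (S : Finset α) (r : α) (g : α → ℕ) (hi : ℕ) :
    ∀ (m : ℕ) (P : α → ℕ), hi ≤ P r + m → RBar S r g hi P →
      ∃ j P', Steps (TokOk S r g) j P P' ∧ P r + j ≤ P' r ∧
      RBar S r g (P' r) P' ∧ (∀ lo, LBar S r g lo P → LBar S r g lo P') ∧
      P' r ≤ hi := by
  intro m
  induction m with
  | zero =>
    intro P hP hR
    have h1 := hR.1
    have : P r = hi := by omega
    exact ⟨0, P, Steps.refl _, by omega, this ▸ hR, fun _ h => h, h1⟩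
  | succ m ih =>
    intro P hP hR
    by_cases hc : ∃ y ∈ S, y ≠ r ∧ g y ≤ P r ∧ P r < P y
    · obtain ⟨y, hyS, hyr, h1, h2⟩ := hc
      have hok : TokOk S r g P r y := ⟨rfl, hyS, hyr, Or.inr ⟨h1, h2⟩⟩
      obtain ⟨j, P', hs, hj, hL, hl, hr⟩ := ih (P ∘ Equiv.swap r y) (by rw [swap_hole]; omega)
        (hR.move hok)
      rw [swap_hole] at hj
      exact ⟨j + 1, P', Steps.head r y hok hs, by omega, hL, fun lo h => hl lo (h.move hok), hr⟩
    · push Not at hc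
      refine ⟨0, P, Steps.refl _, by omega, ⟨le_rfl, fun q hq hqr h => ?_⟩,
        fun _ h => h, hR.1⟩
      by_contra h'
      have := hc q hq hqr (by omega)
      omega

theorem injOn_swap {α β : Type*} [DecidableEq α] {S : Finset α} {P : α → β}
    (h : Set.InjOn P S) {x y : α} (hx : x ∈ S) (hy : y ∈ S) :
    Set.InjOn (P ∘ Equiv.swap x y) S := by
  have hm : ∀ a ∈ S, Equiv.swap x y a ∈ S := by
    intro a ha
    rw [Equiv.swap_apply_def]
    split_ifs <;> assumption
  intro a ha b hb hab
  exact (Equiv.swap x y).injective (h (hm a ha) (hm b hb) hab)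

theorem Steps.injOn {α β : Type*} [DecidableEq α] {ok : (α → β) → α → α → Prop} {S : Finset α}
    (hok : ∀ σ x y, ok σ x y → x ∈ S ∧ y ∈ S) {j : ℕ} {σ τ : α → β} (h : Steps ok j σ τ)
    (hi : Set.InjOn σ S) : Set.InjOn τ S := by
  induction h with
  | refl => exact hi
  | head x y hxy t ih => exact ih (injOn_swap hi (hok _ _ _ hxy).1 (hok _ _ _ hxy).2)

/-- Zigzag with nested barriers. -/
theorem zigzag {α : Type*} [DecidableEq α] (S : Finset α) (r : α) (hrS : r ∈ S) (g : α → ℕ) :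
    ∀ (m : ℕ),
      (∀ (hi : ℕ) (P : α → ℕ), Set.InjOn P S → hi ≤ P r + m → LBar S r g (P r) P → RBar S r g hi P →
        ∃ j P' x y, Steps (TokOk S r g) j P P' ∧ LBar S r g (P' r) P' ∧ RBar S r g (P' r) P' ∧
          P' r = P r + x ∧ P' r + y = hi ∧ j ≤ 2 * x * y + x) ∧
      (∀ (lo : ℕ) (P : α → ℕ), Set.InjOn P S → P r ≤ lo + m → LBar S r g lo P → RBar S r g (P r) P →
        ∃ j P' x y, Steps (TokOk S r g) j P P' ∧ LBar S r g (P' r) P' ∧ RBar S r g (P' r) P' ∧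
          P' r = lo + x ∧ P' r + y = P r ∧ j ≤ 2 * x * y + y) := by
  intro m
  induction m with
  | zero =>
    constructor
    · intro hi P hinj h hL hR
      have h1 := hR.1
      have : P r = hi := by omega
      exact ⟨0, P, 0, 0, Steps.refl _, hL, this ▸ hR, by omega, by omega, by omega⟩
    · intro lo P hinj h hL hR
      have h1 := hL.1
      have : P r = lo := by omega
      exact ⟨0, P, 0, 0, Steps.refl _, this ▸ hL, hR, by omega, by omega, by omega⟩
  | succ m ih =>
    constructor
    · intro hi P hinj h hL hR
      have hle := hR.1
      by_cases hc : ∃ y ∈ S, y ≠ r ∧ g y ≤ P r ∧ P r < P y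
      · obtain ⟨y, hyS, hyr, h1, h2⟩ := hc
        have hok : TokOk S r g P r y := ⟨rfl, hyS, hyr, Or.inr ⟨h1, h2⟩⟩
        have hL1 : LBar S r g (P r + 1) (P ∘ Equiv.swap r y) := by
          refine ⟨by rw [swap_hole]; omega, ?_⟩
          intro q hq hqr
          by_cases hqy : q = y
          · subst hqy; intro; omega
          · rw [swap_other P hqr hqy]
            intro hlt
            have hne := hL.2 q hq hqr
            by_cases hlt' : P q < P r
            · have := hne hlt'; omega
            · exact absurd (hinj hq hrS (by omega)) hqr
        obtain ⟨j, P', hs, hj, hR', hl, hhi⟩ := sweepR S r g hi hi (P ∘ Equiv.swap r y)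
          (by omega) (hR.move hok)
        rw [swap_hole] at hj
        have hinj' : Set.InjOn P' S := hs.injOn
          (fun σ x y hxy => ⟨hxy.1 ▸ hrS, hxy.2.1⟩) (injOn_swap hinj hrS hyS)
        obtain ⟨j2, P2, x, z, hs2, hL2, hR2, hx, hz, hj2⟩ :=
          ih.2 (P r + 1) P' hinj' (by omega) (hl _ hL1) hR'
        obtain ⟨w, hw⟩ : ∃ w, hi = P' r + w := ⟨hi - P' r, by omega⟩
        refine ⟨1 + j + j2, P2, x + 1, z + w, ?_, hL2, hR2, by omega, by omega, ?_⟩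
        · have := (Steps.head r y hok hs).trans hs2
          convert this using 1
          omega
        · have : 1 + j ≤ x + 1 + z := by omega
          nlinarith [Nat.zero_le (x * w), Nat.zero_le w]
      · push Not at hc
        obtain ⟨w, hw⟩ : ∃ w, hi = P r + w := ⟨hi - P r, by omega⟩
        refine ⟨0, P, 0, w, Steps.refl _, hL, ⟨le_rfl, fun q hq hqr h => ?_⟩, by omega, by omega,
          by omega⟩
        by_contra h'
        have := hc q hq hqr (by omega)
        omega
    · intro lo P hinj h hL hR
      have hle := hL.1
      by_cases hc : ∃ y ∈ S, y ≠ r ∧ P y < P r ∧ P r < g y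
      · obtain ⟨y, hyS, hyr, h1, h2⟩ := hc
        have hok : TokOk S r g P r y := ⟨rfl, hyS, hyr, Or.inl ⟨h1, h2⟩⟩
        have hR1 : RBar S r g (P r - 1) (P ∘ Equiv.swap r y) := by
          refine ⟨by rw [swap_hole]; omega, ?_⟩
          intro q hq hqr
          by_cases hqy : q = y
          · subst hqy; intro; omega
          · rw [swap_other P hqr hqy]
            intro hlt
            have hne := hR.2 q hq hqr
            by_cases hlt' : P r < P q
            · have := hne hlt'; omega
            · exact absurd (hinj hq hrS (by omega)) hqr
        obtain ⟨j, P', hs, hj, hL', hl, hhi⟩ := sweepL S r g _ (P ∘ Equiv.swap r y) le_rfl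
        rw [swap_hole] at hj
        have hinj' : Set.InjOn P' S := hs.injOn
          (fun σ x y hxy => ⟨hxy.1 ▸ hrS, hxy.2.1⟩) (injOn_swap hinj hrS hyS)
        have hlo := (hl lo (hL.move hok)).1
        obtain ⟨j2, P2, x, z, hs2, hL2, hR2, hx, hz, hj2⟩ :=
          ih.1 (P r - 1) P' hinj' (by omega) hL' (hhi _ hR1)
        obtain ⟨w, hw⟩ : ∃ w, P' r = lo + w := ⟨P' r - lo, by omega⟩
        refine ⟨1 + j + j2, P2, x + w, z + 1, ?_, hL2, hR2, by omega, by omega, ?_⟩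
        · have := (Steps.head r y hok hs).trans hs2
          convert this using 1
          omega
        · have : 1 + j ≤ x + 1 + z := by omega
          nlinarith [Nat.zero_le (z * w), Nat.zero_le w]
      · push Not at hc
        obtain ⟨w, hw⟩ : ∃ w, P r = lo + w := ⟨P r - lo, by omega⟩
        exact ⟨0, P, w, 0, Steps.refl _, ⟨le_rfl, fun q hq hqr h => hc q hq hqr h⟩, hR, by omega,
          by omega, by omega⟩

/-- The token game can be finished quickly. -/
theorem token {α : Type*} [DecidableEq α] (S : Finset α) (r : α) (hrS : r ∈ S) (g : α → ℕ)
    (P : α → ℕ) (hinj : Set.InjOn P S) (k : ℕ) (hk : ∀ q ∈ S, P q ≤ k) :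
    ∃ j P' y, Steps (TokOk S r g) j P P' ∧ LBar S r g (P' r) P' ∧ RBar S r g (P' r) P' ∧
      P' r + y = k ∧ j ≤ 2 * (P' r * y + P' r + y) := by
  obtain ⟨j, P', hs, hj, hL', hl, hhi⟩ := sweepL S r g _ P le_rfl
  have hinj' : Set.InjOn P' S := hs.injOn
    (fun σ x y hxy => ⟨hxy.1 ▸ hrS, hxy.2.1⟩) hinj
  have hR : RBar S r g k P' := hhi k ⟨hk r hrS, fun q hq _ h => by have := hk q hq; omega⟩
  obtain ⟨j2, P2, x, z, hs2, hL2, hR2, hx, hz, hj2⟩ :=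
    (zigzag S r hrS g k).1 k P' hinj' (by omega) hL' hR
  refine ⟨j + j2, P2, z, hs.trans hs2, hL2, hR2, hz, ?_⟩
  have := hk r hrS
  have h1 : j ≤ x + z := by omega
  rw [hx]
  nlinarith [Nat.zero_le (P' r * z), Nat.zero_le (P' r)]

/-! ### Coordinates and crossings -/

/-- Affine coordinates on the plane. -/
structure Coord where
  X : Pt → ℝ
  Y : Pt → ℝ
  hX : ∀ (a b : Pt) (s t : ℝ), s + t = 1 → X (s • a + t • b) = s * X a + t * X b
  hY : ∀ (a b : Pt) (s t : ℝ), s + t = 1 → Y (s • a + t • b) = s * Y a + t * Y b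
  inj : ∀ p q, X p = X q → Y p = Y q → p = q

/-- Orientation of `q` with respect to the line `rb` (where `b` has height `0`). -/
def Coord.D (C : Coord) (r b q : Pt) : ℝ := (C.X r - C.X b) * C.Y q - (C.X q - C.X b) * C.Y r

theorem Coord.hD (C : Coord) (r c : Pt) (a b : Pt) (s t : ℝ) (h : s + t = 1) :
    C.D r c (s • a + t • b) = s * C.D r c a + t * C.D r c b := by
  unfold Coord.D
  rw [C.hX a b s t h, C.hY a b s t h]
  have : s = 1 - t := by linarith
  subst this
  ring

theorem segCross_symm {a b c d : Pt} (h : SegCross a b c d) : SegCross c d a b := by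
  obtain ⟨h1, h2, h3, h4, h5, h6, x, hx, hx'⟩ := h
  exact ⟨h6, h2.symm, h4.symm, h3.symm, h5.symm, h1, x, hx', hx⟩

theorem not_cross_of_sep (φ : Pt → ℝ)
    (hφ : ∀ (a b : Pt) (s t : ℝ), s + t = 1 → φ (s • a + t • b) = s * φ a + t * φ b)
    {a b c d : Pt} (ha : φ a ≤ 0) (hb : φ b ≤ 0) (hc : 0 ≤ φ c) (hd : 0 ≤ φ d)
    (hs : φ a < 0 ∨ φ c > 0) : ¬ SegCross a b c d := by
  rintro ⟨-, -, -, -, -, -, x, ⟨s, t, hs0, ht0, hst, rfl⟩, ⟨s', t', hs0', ht0', hst', hx⟩⟩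
  have h1 := hφ a b s t hst
  have h2 := hφ c d s' t' hst'
  rw [hx, h1] at h2
  have e1 : s * φ a ≤ 0 := mul_nonpos_of_nonneg_of_nonpos hs0.le ha
  have e2 : t * φ b ≤ 0 := mul_nonpos_of_nonneg_of_nonpos ht0.le hb
  have e3 : 0 ≤ s' * φ c := mul_nonneg hs0'.le hc
  have e4 : 0 ≤ t' * φ d := mul_nonneg ht0'.le hd
  rcases hs with hs | hs
  · have : s * φ a < 0 := mul_neg_of_pos_of_neg hs0 hs
    linarith
  · have : 0 < s' * φ c := mul_pos hs0' hs
    linarith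

theorem Coord.cross (C : Coord) {r b q c : Pt} (hq : 0 < C.Y q) (hqr : C.Y q ≤ C.Y r)
    (hb : C.Y b = 0) (hc : C.Y c = 0) (h : C.D r b q * C.D r b c < 0) : SegCross r b q c := by
  have hr : 0 < C.Y r := hq.trans_le hqr
  have hrr : C.D r b r = 0 := by unfold Coord.D; ring
  have hbb : C.D r b b = 0 := by unfold Coord.D; rw [hb]; ring
  refine ⟨?_, ?_, ?_, ?_, ?_, ?_, ?_⟩
  · rintro rfl; linarith
  · rintro rfl; rw [hrr] at h; linarith
  · rintro rfl; linarith
  · rintro rfl; linarith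
  · rintro rfl; rw [hbb] at h; linarith
  · rintro rfl; linarith
  · set u := C.D r b q with hu
    set v := C.D r b c with hv
    have hne : u - v ≠ 0 := by
      intro h0
      have : u = v := by linarith
      rw [this] at h
      nlinarith [mul_self_nonneg v]
    -- weights
    have hs : 0 < -v / (u - v) := by
      rcases lt_trichotomy v 0 with h1 | h1 | h1
      · have : 0 < u := by nlinarith
        exact div_pos (by linarith) (by linarith)
      · rw [h1] at h; linarith
      · have : u < 0 := by nlinarith
        exact div_pos_of_neg_of_neg (by linarith) (by linarith)
    have ht : 0 < u / (u - v) := by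
      rcases lt_trichotomy v 0 with h1 | h1 | h1
      · have : 0 < u := by nlinarith
        exact div_pos (by linarith) (by linarith)
      · rw [h1] at h; linarith
      · have : u < 0 := by nlinarith
        exact div_pos_of_neg_of_neg (by linarith) (by linarith)
    have hst : -v / (u - v) + u / (u - v) = 1 := by
      field_simp
      ring
    set s := -v / (u - v) with hsdef
    set t := u / (u - v) with htdef
    have hz : C.D r b (s • q + t • c) = 0 := by
      rw [C.hD r b q c s t hst, ← hu, ← hv, hsdef, htdef]
      field_simp
      ring
    have hYz : C.Y (s • q + t • c) = s * C.Y q := by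
      rw [C.hY q c s t hst, hc]; ring
    have hs1 : s < 1 := by linarith
    have hlt : s * C.Y q < C.Y r := by nlinarith
    have hpos : 0 < s * C.Y q := mul_pos hs hq
    have hw : s * C.Y q / C.Y r + (1 - s * C.Y q / C.Y r) = 1 := by ring
    refine ⟨s • q + t • c, ?_, s, t, hs, ht, hst, rfl⟩
    refine ⟨s * C.Y q / C.Y r, 1 - s * C.Y q / C.Y r, div_pos hpos hr, ?_, hw, ?_⟩
    · have := (div_lt_one hr).2 hlt
      linarith
    · apply C.inj
      · rw [C.hX r b _ _ hw]
        unfold Coord.D at hz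
        rw [hYz] at hz
        set z := C.X (s • q + t • c)
        field_simp
        linarith
      · rw [C.hY r b _ _ hw, hYz, hb]
        field_simp
        ring

/-- Number of points of `Bs` to the left of `b`. -/
def Coord.pos (C : Coord) (Bs : Finset Pt) (b : Pt) : ℕ := (Bs.filter (fun c => C.X c < C.X b)).card

/-- Number of points `c` of `Bs` such that `q` is not to the left of `rc`. -/
def Coord.tgt (C : Coord) (Bs : Finset Pt) (r q : Pt) : ℕ :=
  (Bs.filter (fun c => ¬ 0 < C.D r c q)).card

theorem Coord.pos_lt (C : Coord) {Bs : Finset Pt} {b c : Pt} (hb : b ∈ Bs) :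
    C.pos Bs b < C.pos Bs c ↔ C.X b < C.X c := by
  unfold Coord.pos
  constructor
  · intro h
    by_contra h'
    push Not at h'
    refine absurd (Finset.card_le_card ?_) (not_le.2 h)
    intro x
    simp only [Finset.mem_filter]
    rintro ⟨h1, h2⟩
    exact ⟨h1, h2.trans_le h'⟩
  · intro h
    apply Finset.card_lt_card
    rw [Finset.ssubset_iff_of_subset]
    · exact ⟨b, by simp [hb, h], by simp⟩
    · intro x
      simp only [Finset.mem_filter]
      rintro ⟨h1, h2⟩
      exact ⟨h1, h2.trans h⟩

theorem Coord.D_mono (C : Coord) {r q b c : Pt} (hqr : C.Y q ≤ C.Y r) (h : C.X b ≤ C.X c) :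
    C.D r b q ≤ C.D r c q := by
  unfold Coord.D
  nlinarith

theorem Coord.tgt_le (C : Coord) {Bs : Finset Pt} {r q b : Pt} (hqr : C.Y q ≤ C.Y r)
    (hb : b ∈ Bs) : C.tgt Bs r q ≤ C.pos Bs b ↔ 0 < C.D r b q := by
  unfold Coord.pos Coord.tgt
  constructor
  · intro h
    by_contra h'
    refine absurd h (not_le.2 (Finset.card_lt_card ?_))
    rw [Finset.ssubset_iff_of_subset]
    · exact ⟨b, by simp only [Finset.mem_filter]; exact ⟨hb, h'⟩, by simp⟩
    · intro x
      simp only [Finset.mem_filter]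
      rintro ⟨h1, h2⟩
      refine ⟨h1, fun h3 => h' ?_⟩
      exact h3.trans_le (C.D_mono hqr h2.le)
  · intro h
    apply Finset.card_le_card
    intro x
    simp only [Finset.mem_filter]
    rintro ⟨h1, h2⟩
    refine ⟨h1, ?_⟩
    by_contra h3
    exact h2 (h.trans_le (C.D_mono hqr (not_lt.1 h3)))

/-- Flips within `S`. -/
def FOk (S : Finset Pt) (σ : Pt → Pt) (x y : Pt) : Prop :=
  x ∈ S ∧ y ∈ S ∧ SegCross x (σ x) y (σ y)

theorem swap_mem' {α : Type*} [DecidableEq α] {S : Finset α} {x y a : α} (hx : x ∈ S) (hy : y ∈ S)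
    (ha : a ∈ S) : Equiv.swap x y a ∈ S := by
  rw [Equiv.swap_apply_def]
  split_ifs <;> assumption

open scoped Classical in
theorem steps_off {S : Finset Pt} {j : ℕ} {σ τ : Pt → Pt} (h : Steps (FOk S) j σ τ) :
    ∀ q, q ∉ S → τ q = σ q := by
  induction h with
  | refl => intro _ _; rfl
  | @head j σ τ x y hxy t ih =>
    intro q hq
    rw [ih q hq]
    have h1 : q ≠ x := fun e => hq (e ▸ hxy.1)
    have h2 : q ≠ y := fun e => hq (e ▸ hxy.2.1)
    simp [Equiv.swap_apply_of_ne_of_ne h1 h2]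

open scoped Classical in
theorem steps_ex {S : Finset Pt} {j : ℕ} {σ τ : Pt → Pt} (h : Steps (FOk S) j σ τ) :
    ∀ q ∈ S, ∃ q' ∈ S, τ q = σ q' := by
  induction h with
  | refl => intro q hq; exact ⟨q, hq, rfl⟩
  | @head j σ τ x y hxy t ih =>
    intro q hq
    obtain ⟨q', hq', e⟩ := ih q hq
    exact ⟨_, swap_mem' hxy.1 hxy.2.1 hq', e⟩

/-- Lifting a token game to flips. -/
theorem lift_token [DecidableEq Pt] (C : Coord) (S Bs : Finset Pt) (r : Pt) (hr : r ∈ S)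
    (hpos : ∀ q ∈ S, 0 < C.Y q) (htop : ∀ q ∈ S, C.Y q ≤ C.Y r)
    (hB : ∀ b ∈ Bs, C.Y b = 0)
    (hgen : ∀ p ∈ S, ∀ q ∈ S, p ≠ q → ∀ c ∈ Bs, C.D p c q ≠ 0)
    {j : ℕ} {P P' : Pt → ℕ} (h : Steps (TokOk S r (C.tgt Bs r)) j P P') :
    ∀ σ : Pt → Pt, (∀ q ∈ S, σ q ∈ Bs) → P = C.pos Bs ∘ σ →
      ∃ τ, Steps (FOk S) j σ τ ∧ P' = C.pos Bs ∘ τ ∧ (∀ q ∈ S, τ q ∈ Bs) := by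
  induction h with
  | refl => intro σ hσ hP; exact ⟨σ, Steps.refl _, hP, hσ⟩
  | @head j P P' x y hxy t ih =>
    intro σ hσ hP
    subst hP
    obtain ⟨rfl, hy, hyx, hc⟩ := hxy
    obtain ⟨τ, hs, hP', hτ⟩ := ih (σ ∘ Equiv.swap x y)
      (fun q hq => hσ _ (swap_mem' hr hy hq)) rfl
    refine ⟨τ, Steps.head x y ⟨hr, hy, ?_⟩ hs, hP', hτ⟩
    have hx0 := hpos x hr
    have hne := hgen x hr y hy hyx.symm (σ x) (hσ x hr)
    have hDc : C.D x (σ x) (σ y) = (C.X (σ x) - C.X (σ y)) * C.Y x := by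
      unfold Coord.D
      rw [hB _ (hσ y hy)]
      ring
    apply C.cross (hpos y hy) (htop y hy) (hB _ (hσ x hr)) (hB _ (hσ y hy))
    simp only [Function.comp] at hc
    rw [hDc]
    rcases hc with ⟨h1, h2⟩ | ⟨h1, h2⟩
    · rw [C.pos_lt (hσ y hy)] at h1
      rw [← not_le, C.tgt_le (htop y hy) (hσ x hr)] at h2
      have h3 : C.D x (σ x) y < 0 := lt_of_le_of_ne (not_lt.1 h2) hne
      exact mul_neg_of_neg_of_pos h3 (mul_pos (by linarith) hx0)
    · rw [C.pos_lt (hσ x hr)] at h2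
      rw [C.tgt_le (htop y hy) (hσ x hr)] at h1
      exact mul_neg_of_pos_of_neg h1 (mul_neg_of_neg_of_pos (by linarith) hx0)

open scoped Classical in
/-- All red points above the line. -/
theorem upper (C : Coord) : ∀ (k : ℕ) (S : Finset Pt), S.card = k → ∀ σ : Pt → Pt,
    Set.InjOn σ S → (∀ q ∈ S, 0 < C.Y q) → (∀ q ∈ S, C.Y (σ q) = 0) →
    (∀ p ∈ S, ∀ q ∈ S, p ≠ q → ∀ c ∈ S, C.D p (σ c) q ≠ 0) →
    ∃ j τ, j + k ≤ k * k ∧ Steps (FOk S) j σ τ ∧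
      ∀ p ∈ S, ∀ q ∈ S, ¬ SegCross p (τ p) q (τ q) := by
  intro k
  induction k using Nat.strong_induction_on with
  | _ k ih =>
  intro S hS σ hinj hpos hzero hgen
  rcases S.eq_empty_or_nonempty with rfl | hne
  · simp at hS
    subst hS
    exact ⟨0, σ, by simp, Steps.refl _, by simp⟩
  obtain ⟨r, hr, htop⟩ := Finset.exists_max_image S C.Y hne
  set Bs := S.image σ with hBs
  have hBcard : Bs.card = k := by rw [hBs, Finset.card_image_of_injOn hinj, hS]
  have hB : ∀ b ∈ Bs, C.Y b = 0 := by
    intro b hb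
    obtain ⟨q, hq, rfl⟩ := Finset.mem_image.1 hb
    exact hzero q hq
  have hgen' : ∀ p ∈ S, ∀ q ∈ S, p ≠ q → ∀ c ∈ Bs, C.D p c q ≠ 0 := by
    intro p hp q hq hpq c hc
    obtain ⟨a, ha, rfl⟩ := Finset.mem_image.1 hc
    exact hgen p hp q hq hpq a ha
  have hσB : ∀ q ∈ S, σ q ∈ Bs := fun q hq => Finset.mem_image_of_mem _ hq
  have hXinj : ∀ b ∈ Bs, ∀ c ∈ Bs, C.X b = C.X c → b = c := fun b hb c hc h =>
    C.inj _ _ h (by rw [hB b hb, hB c hc])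
  have hPinj : Set.InjOn (C.pos Bs ∘ σ) S := by
    intro a ha b hb hab
    apply hinj ha hb
    apply hXinj _ (hσB a ha) _ (hσB b hb)
    simp only [Function.comp] at hab
    have h1 := C.pos_lt (c := σ b) (hσB a ha)
    have h2 := C.pos_lt (c := σ a) (hσB b hb)
    rw [hab] at h1 h2
    simp at h1 h2
    linarith
  have hPk : ∀ q ∈ S, (C.pos Bs ∘ σ) q ≤ k - 1 := by
    intro q hq
    have : C.pos Bs (σ q) < Bs.card := by
      apply Finset.card_lt_card
      rw [Finset.ssubset_iff_of_subset (Finset.filter_subset _ _)]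
      exact ⟨σ q, hσB q hq, by simp⟩
    simp only [Function.comp]
    omega
  obtain ⟨j, P', y, hs, hL, hR, hy, hj⟩ :=
    token S r hr (C.tgt Bs r) (C.pos Bs ∘ σ) hPinj (k - 1) hPk
  obtain ⟨τ, hsτ, rfl, hτB⟩ := lift_token C S Bs r hr hpos htop hB hgen' hs σ hσB rfl
  have hτinj : Set.InjOn τ S := hsτ.injOn (fun _ _ _ h => ⟨h.1, h.2.1⟩) hinj
  simp only [Function.comp] at hy hj
  have himg : S.image τ = Bs := by
    apply Finset.eq_of_subset_of_card_le
    · intro b hb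
      obtain ⟨q, hq, rfl⟩ := Finset.mem_image.1 hb
      exact hτB q hq
    · rw [Finset.card_image_of_injOn hτinj, hS, hBcard]
  set SL := S.filter (fun q => C.X (τ q) < C.X (τ r)) with hSL
  set SR := (S.filter (fun q => ¬ C.X (τ q) < C.X (τ r))).erase r with hSR
  have hSLsub : SL ⊆ S := Finset.filter_subset _ _
  have hSRsub : SR ⊆ S := (Finset.erase_subset _ _).trans (Finset.filter_subset _ _)
  have hSLcard : SL.card = C.pos Bs (τ r) := by
    rw [← Finset.card_image_of_injOn (hτinj.mono (Finset.coe_subset.2 hSLsub))]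
    unfold Coord.pos
    congr 1
    ext b
    rw [← himg]
    simp only [hSL, Finset.mem_image, Finset.mem_filter]
    constructor
    · rintro ⟨q, ⟨h1, h2⟩, rfl⟩
      exact ⟨⟨q, h1, rfl⟩, h2⟩
    · rintro ⟨⟨q, h1, rfl⟩, h2⟩
      exact ⟨q, ⟨h1, h2⟩, rfl⟩
  have hkpos : 0 < k := by rw [← hS]; exact hne.card_pos
  have hSRcard : SR.card = y := by
    have h1 := Finset.card_filter_add_card_filter_not (s := S) (fun q => C.X (τ q) < C.X (τ r))
    rw [← hSL, hSLcard, hS] at h1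
    rw [hSR, Finset.card_erase_of_mem (by simp [hr])]
    omega
  -- facts about left and right tokens
  have hLf : ∀ q ∈ SL, 0 < C.D r (τ r) q := by
    intro q hq
    have hqS := hSLsub hq
    have hlt : C.X (τ q) < C.X (τ r) := (Finset.mem_filter.1 hq).2
    have hqr : q ≠ r := by rintro rfl; exact lt_irrefl _ hlt
    have := hL.2 q hqS hqr ((C.pos_lt (hτB q hqS)).2 hlt)
    exact (C.tgt_le (htop q hqS) (hτB r hr)).1 this
  have hRx : ∀ q ∈ SR, C.X (τ r) < C.X (τ q) := by
    intro q hq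
    have hqS := hSRsub hq
    have h2 := Finset.mem_erase.1 hq
    have h3 := (Finset.mem_filter.1 h2.2).2
    refine lt_of_le_of_ne (not_lt.1 h3) fun h => h2.1 ?_
    exact (hτinj hr hqS (hXinj _ (hτB r hr) _ (hτB q hqS) h)).symm
  have hRf : ∀ q ∈ SR, C.D r (τ r) q < 0 := by
    intro q hq
    have hqS := hSRsub hq
    have hqr : q ≠ r := (Finset.mem_erase.1 hq).1
    have h1 := hR.2 q hqS hqr ((C.pos_lt (hτB r hr)).2 (hRx q hq))
    simp only [Function.comp] at h1
    rw [← not_le, C.tgt_le (htop q hqS) (hτB r hr)] at h1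
    exact lt_of_le_of_ne (not_lt.1 h1) (hgen' r hr q hqS hqr.symm _ (hτB r hr))
  have hdisj : ∀ q ∈ SL, q ∉ SR := by
    intro q hq hq'
    have := hLf q hq
    have := hRf q hq'
    linarith
  have hrL : r ∉ SL := by simp [hSL]
  have hrR : r ∉ SR := by simp [hSR]
  -- recursion on the left
  obtain ⟨j1, τ1, hj1, hs1, hp1⟩ := ih SL.card (by omega) SL rfl τ
    (hτinj.mono (Finset.coe_subset.2 hSLsub)) (fun q hq => hpos q (hSLsub hq))
    (fun q hq => hB _ (hτB q (hSLsub hq)))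
    (fun p hp q hq hpq c hc => hgen' p (hSLsub hp) q (hSLsub hq) hpq _ (hτB c (hSLsub hc)))
  have off1 := steps_off hs1
  have e1 : ∀ q ∈ SR, τ1 q = τ q := fun q hq => off1 q fun h => hdisj q h hq
  -- recursion on the right
  obtain ⟨j2, τ2, hj2, hs2, hp2⟩ := ih SR.card (by omega) SR rfl τ1
    (by
      intro a ha b hb hab
      rw [e1 a ha, e1 b hb] at hab
      exact hτinj (hSRsub ha) (hSRsub hb) hab) (fun q hq => hpos q (hSRsub hq))
    (fun q hq => by rw [e1 q hq]; exact hB _ (hτB q (hSRsub hq)))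
    (fun p hp q hq hpq c hc => by
      rw [e1 c hc]; exact hgen' p (hSRsub hp) q (hSRsub hq) hpq _ (hτB c (hSRsub hc)))
  have off2 := steps_off hs2
  have e2 : ∀ q ∈ SL, τ2 q = τ1 q := fun q hq => off2 q (hdisj q hq)
  have er : τ2 r = τ r := by rw [off2 r hrR, off1 r hrL]
  have mono : ∀ T ⊆ S, ∀ ρ x y, FOk T ρ x y → FOk S ρ x y :=
    fun T hT ρ x y h => ⟨hT h.1, hT h.2.1, h.2.2⟩
  refine ⟨j + j1 + j2, τ2, ?_, (hsτ.trans (hs1.mono (mono SL hSLsub))).trans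
    (hs2.mono (mono SR hSRsub)), ?_⟩
  · rw [hSLcard] at hj1
    rw [hSRcard] at hj2
    generalize C.pos Bs (τ r) = x at *
    have : k = x + y + 1 := by omega
    subst this
    nlinarith
  have hDb : ∀ c ∈ Bs, C.D r (τ r) c = (C.X (τ r) - C.X c) * C.Y r := by
    intro c hc
    unfold Coord.D
    rw [hB _ hc]
    ring
  have hr0 := hpos r hr
  have fL : ∀ q ∈ SL, 0 < C.D r (τ r) (τ2 q) := by
    intro q hq
    rw [e2 q hq]
    obtain ⟨q', hq', e⟩ := steps_ex hs1 q hq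
    rw [e, hDb _ (hτB _ (hSLsub hq'))]
    have := (Finset.mem_filter.1 hq').2
    exact mul_pos (by linarith) hr0
  have fR : ∀ q ∈ SR, C.D r (τ r) (τ2 q) < 0 := by
    intro q hq
    obtain ⟨q', hq', e⟩ := steps_ex hs2 q hq
    rw [e, e1 q' hq', hDb _ (hτB _ (hSRsub hq'))]
    have := hRx q' hq'
    exact mul_neg_of_neg_of_pos (by linarith) hr0
  have frr : C.D r (τ r) r = 0 := by unfold Coord.D; ring
  have frb : C.D r (τ r) (τ2 r) = 0 := by rw [er, hDb _ (hτB r hr)]; ring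
  have hcases : ∀ q ∈ S, q = r ∨ q ∈ SL ∨ q ∈ SR := by
    intro q hq
    by_cases h1 : q = r
    · exact Or.inl h1
    · by_cases h2 : C.X (τ q) < C.X (τ r)
      · exact Or.inr (Or.inl (Finset.mem_filter.2 ⟨hq, h2⟩))
      · exact Or.inr (Or.inr (Finset.mem_erase.2 ⟨h1, Finset.mem_filter.2 ⟨hq, h2⟩⟩))
  have rl : ∀ p ∈ SL, ¬ SegCross r (τ2 r) p (τ2 p) := fun p hp =>
    not_cross_of_sep (C.D r (τ r)) (C.hD r (τ r)) frr.le frb.le (hLf p hp).le (fL p hp).le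
      (Or.inr (hLf p hp))
  have rr : ∀ p ∈ SR, ¬ SegCross p (τ2 p) r (τ2 r) := fun p hp =>
    not_cross_of_sep (C.D r (τ r)) (C.hD r (τ r)) (hRf p hp).le (fR p hp).le frr.ge frb.ge
      (Or.inl (hRf p hp))
  have lr : ∀ p ∈ SR, ∀ q ∈ SL, ¬ SegCross p (τ2 p) q (τ2 q) := fun p hp q hq =>
    not_cross_of_sep (C.D r (τ r)) (C.hD r (τ r)) (hRf p hp).le (fR p hp).le (hLf q hq).le
      (fL q hq).le (Or.inl (hRf p hp))
  intro p hp q hq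
  rcases hcases p hp with rfl | hp' | hp' <;> rcases hcases q hq with h | hq' | hq'
  · subst h; exact fun h => h.2.1 rfl
  · exact rl q hq'
  · exact fun h => rr q hq' (segCross_symm h)
  · subst h; exact fun h => rl p hp' (segCross_symm h)
  · rw [e2 p hp', e2 q hq']; exact hp1 p hp' q hq'
  · exact fun h => lr q hq' p hp' (segCross_symm h)
  · subst h; exact rr p hp'
  · exact lr p hp' q hq'
  · exact hp2 p hp' q hq'

/-- Reflected coordinates. -/
def Coord.refl (C : Coord) : Coord where
  X := C.X
  Y := fun p => - C.Y p
  hX := C.hX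
  hY := fun a b s t h => by rw [C.hY a b s t h]; ring
  inj := fun p q h h' => C.inj p q h (by linarith)

/-- Coordinates adapted to the line through `u` and `w`. -/
theorem exists_coord (u w : Pt) (h : u ≠ w) :
    ∃ C : Coord, ∀ p, C.Y p = 0 ↔ p ∈ affineSpan ℝ {u, w} := by
  have hpos : 0 < (w 0 - u 0) ^ 2 + (w 1 - u 1) ^ 2 := by
    by_contra hn
    apply h
    have h0 : w 0 - u 0 = 0 := by nlinarith [sq_nonneg (w 0 - u 0), sq_nonneg (w 1 - u 1)]
    have h1 : w 1 - u 1 = 0 := by nlinarith [sq_nonneg (w 0 - u 0), sq_nonneg (w 1 - u 1)]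
    ext i
    fin_cases i
    · simp; linarith
    · simp; linarith
  set v0 := w 0 - u 0 with hv0
  set v1 := w 1 - u 1 with hv1
  let C : Coord :=
    { X := fun p => v0 * (p 0 - u 0) + v1 * (p 1 - u 1)
      Y := fun p => v0 * (p 1 - u 1) - v1 * (p 0 - u 0)
      hX := by
        intro a b s t hst
        have : s = 1 - t := by linarith
        subst this
        simp
        ring
      hY := by
        intro a b s t hst
        have : s = 1 - t := by linarith
        subst this
        simp
        ring
      inj := by
        intro p q h1 h2
        have e0 : (v0 ^ 2 + v1 ^ 2) * (p 0 - q 0) = 0 := by linear_combination v0 * h1 - v1 * h2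
        have e1 : (v0 ^ 2 + v1 ^ 2) * (p 1 - q 1) = 0 := by linear_combination v1 * h1 + v0 * h2
        have e0' := (mul_eq_zero.1 e0).resolve_left hpos.ne'
        have e1' := (mul_eq_zero.1 e1).resolve_left hpos.ne'
        ext i
        fin_cases i
        · simp; linarith
        · simp; linarith }
  refine ⟨C, fun p => ?_⟩
  rw [mem_affineSpan_pair_iff_exists_lineMap_eq]
  constructor
  · intro hp
    have hp' : v0 * (p 1 - u 1) - v1 * (p 0 - u 0) = 0 := hp
    refine ⟨(v0 * (p 0 - u 0) + v1 * (p 1 - u 1)) / (v0 ^ 2 + v1 ^ 2), ?_⟩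
    ext i
    fin_cases i
    · simp [AffineMap.lineMap_apply]
      rw [← hv0]
      field_simp
      linear_combination v1 * hp'
    · simp [AffineMap.lineMap_apply]
      rw [← hv1]
      field_simp
      linear_combination (-v0) * hp'
  · rintro ⟨t, rfl⟩
    show v0 * ((AffineMap.lineMap u w t : Pt) 1 - u 1) - v1 * ((AffineMap.lineMap u w t : Pt) 0 - u 0) = 0
    simp [AffineMap.lineMap_apply]
    rw [← hv0, ← hv1]
    ring

theorem Coord.collinear (C : Coord) {p q c : Pt} (hp : C.Y p ≠ 0) (hc : C.Y c = 0)
    (h : C.D p c q = 0) : Collinear ℝ ({p, q, c} : Set Pt) := by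
  rw [collinear_iff_of_mem (p₀ := c) (by simp)]
  refine ⟨p - c, ?_⟩
  have hq : q = (C.Y q / C.Y p) • p + (1 - C.Y q / C.Y p) • c := by
    apply C.inj
    · rw [C.hX _ _ _ _ (by ring)]
      unfold Coord.D at h
      field_simp
      linarith
    · rw [C.hY _ _ _ _ (by ring), hc]
      field_simp
      ring
  intro x hx
  simp only [Set.mem_insert_iff, Set.mem_singleton_iff] at hx
  rcases hx with rfl | rfl | rfl
  · exact ⟨1, by simp⟩
  · refine ⟨C.Y x / C.Y p, ?_⟩
    conv_lhs => rw [hq]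
    simp only [vadd_eq_add]
    module
  · exact ⟨0, by simp⟩

/-- The matching given by `σ` on `S`. -/
def gr (S : Finset Pt) (σ : Pt → Pt) : Set (Pt × Pt) := {e | e.1 ∈ S ∧ e.2 = σ e.1}

open scoped Classical in
theorem gr_flip {S : Finset Pt} {σ : Pt → Pt} {x y : Pt} (hinj : Set.InjOn σ S)
    (h : FOk S σ x y) :
    BiFlip (gr S σ) (gr S (σ ∘ Equiv.swap x y)) := by
  obtain ⟨hx, hy, hc⟩ := h
  refine ⟨x, σ x, y, σ y, ⟨hx, rfl⟩, ⟨hy, rfl⟩, hc, ?_⟩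
  have hxy : x ≠ y := hc.2.1
  have hσ : σ x ≠ σ y := hc.2.2.2.2.1
  ext ⟨a, b⟩
  simp only [gr, Set.mem_ofPred_eq, Function.comp, Set.mem_union, Set.mem_sdiff, Set.mem_insert_iff,
    Set.mem_singleton_iff, Prod.mk.injEq, not_or, not_and]
  by_cases h1 : a = x
  · subst h1
    rw [Equiv.swap_apply_left]
    constructor
    · rintro ⟨-, rfl⟩; exact Or.inr (Or.inl ⟨rfl, rfl⟩)
    · rintro (⟨⟨-, h2⟩, h3, -⟩ | ⟨-, h2⟩ | ⟨h2, -⟩)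
      · exact absurd h2 (h3 rfl)
      · exact ⟨hx, h2⟩
      · exact absurd h2 hxy
  · by_cases h2 : a = y
    · subst h2
      rw [Equiv.swap_apply_right]
      constructor
      · rintro ⟨-, rfl⟩; exact Or.inr (Or.inr ⟨rfl, rfl⟩)
      · rintro (⟨⟨-, h2⟩, -, h3⟩ | ⟨h2, -⟩ | ⟨-, h2⟩)
        · exact absurd h2 (h3 rfl)
        · exact absurd h2 h1
        · exact ⟨hy, h2⟩
    · rw [Equiv.swap_apply_of_ne_of_ne h1 h2]
      constructor
      · rintro h; exact Or.inl ⟨h, fun h => absurd h h1, fun h => absurd h h2⟩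
      · rintro (⟨h, -⟩ | ⟨h, -⟩ | ⟨h, -⟩)
        · exact h
        · exact absurd h h1
        · exact absurd h h2

open scoped Classical in
theorem steps_toPlane {S : Finset Pt} {j : ℕ} {σ τ : Pt → Pt} (h : Steps (FOk S) j σ τ)
    (hinj : Set.InjOn σ S) (hp : ∀ p ∈ S, ∀ q ∈ S, ¬ SegCross p (τ p) q (τ q)) :
    BiFlipsToPlane (gr S σ) j := by
  induction h with
  | refl σ =>
    refine ⟨0, fun _ => gr S σ, le_rfl, rfl, fun i hi => absurd hi (by omega), ?_⟩
    rintro ⟨a, b⟩ ⟨ha, hb⟩ ⟨c, d⟩ ⟨hc, hd⟩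
    simp only at ha hb hc hd
    subst hb hd
    exact hp a ha c hc
  | @head j σ τ x y hxy t ih =>
    obtain ⟨i, g, hi, h0, hstep, hpl⟩ := ih (injOn_swap hinj hxy.1 hxy.2.1) hp
    refine ⟨i + 1, fun n => Nat.casesOn n (gr S σ) g, by omega, rfl, ?_, hpl⟩
    intro n hn
    cases n with
    | zero =>
      show BiFlip (gr S σ) (g 0)
      rw [h0]
      exact gr_flip hinj hxy
    | succ n => exact hstep n (by omega)

/-- Let `P = R ∪ B` consist of `n/2` blue points on a line `ℓ` and
`n/2` red points off `ℓ`, with no three points collinear except blue points on `ℓ`.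
Then every perfect bichromatic matching on `P` can be made plane by at most
`n²/4 - n/2` flips. -/
theorem stmt18 (n : ℕ) (hn : Even n) (R B : Finset Pt)
    (hR : R.card = n / 2) (hB : B.card = n / 2)
    (ℓ : AffineSubspace ℝ Pt) (hline : ∃ u w : Pt, u ≠ w ∧ ℓ = affineSpan ℝ {u, w})
    (hblue : ∀ b ∈ B, b ∈ ℓ)
    (hred : ∀ r ∈ R, r ∉ ℓ)
    (hcol : ∀ p ∈ ↑R ∪ (↑B : Set Pt), ∀ q ∈ ↑R ∪ (↑B : Set Pt),
      ∀ x ∈ ↑R ∪ (↑B : Set Pt), p ≠ q → p ≠ x → q ≠ x →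
        Collinear ℝ ({p, q, x} : Set Pt) → (p ∈ ℓ ∧ q ∈ ℓ ∧ x ∈ ℓ))
    (M : Set (Pt × Pt)) (hM : IsBiPM R B M) :
    ∃ k : ℕ, (k : ℝ) ≤ (n : ℝ) ^ 2 / 4 - (n : ℝ) / 2 ∧ BiFlipsToPlane M k := by
  classical
  obtain ⟨u, w, huw, rfl⟩ := hline
  obtain ⟨C, hC⟩ := exists_coord u w huw
  obtain ⟨hM1, hM2, hM3⟩ := hM
  -- the matching as a function
  have hex : ∀ r : Pt, ∃ b : Pt, r ∈ R → (r, b) ∈ M := by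
    intro r
    by_cases hr : r ∈ R
    · obtain ⟨⟨a, b⟩, ⟨he, ha⟩, -⟩ := hM2 r hr
      simp only at ha
      subst ha
      exact ⟨b, fun _ => he⟩
    · exact ⟨r, fun h => absurd h hr⟩
  choose σ hσ using hex
  have hMgr : M = gr R σ := by
    ext ⟨a, b⟩
    constructor
    · intro h
      have ha := (hM1 _ h).1
      refine ⟨ha, ?_⟩
      have := (hM2 a ha).unique ⟨h, rfl⟩ ⟨hσ a ha, rfl⟩
      exact congrArg Prod.snd this
    · rintro ⟨ha, hb⟩
      simp only at ha hb
      subst hb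
      exact hσ a ha
  have hσB : ∀ r ∈ R, σ r ∈ B := fun r hr => (hM1 _ (hσ r hr)).2
  have hinj : Set.InjOn σ R := by
    intro a ha b hb hab
    have := (hM3 (σ a) (hσB a ha)).unique ⟨hσ a ha, rfl⟩ ⟨hσ b hb, hab.symm⟩
    exact congrArg Prod.fst this
  have hz : ∀ r ∈ R, C.Y (σ r) = 0 := fun r hr => (hC _).2 (hblue _ (hσB r hr))
  have hnz : ∀ r ∈ R, C.Y r ≠ 0 := fun r hr h => hred r hr ((hC _).1 h)
  have hgen : ∀ p ∈ R, ∀ q ∈ R, p ≠ q → ∀ c ∈ R, C.D p (σ c) q ≠ 0 := by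
    intro p hp q hq hpq c hc h
    have hcol' := C.collinear (hnz p hp) (hz c hc) h
    refine hred p hp (hcol p (Or.inl hp) q (Or.inl hq) (σ c) (Or.inr (hσB c hc)) hpq ?_ ?_ hcol').1
    · intro e; exact hnz p hp (e ▸ hz c hc)
    · intro e; exact hnz q hq (e ▸ hz c hc)
  set U := R.filter (fun r => 0 < C.Y r) with hU
  set V := R.filter (fun r => ¬ 0 < C.Y r) with hV
  have hUs : U ⊆ R := Finset.filter_subset _ _
  have hVs : V ⊆ R := Finset.filter_subset _ _
  have hcard : U.card + V.card = n / 2 := by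
    rw [← hR]; exact Finset.card_filter_add_card_filter_not _
  have hUp : ∀ q ∈ U, 0 < C.Y q := fun q hq => (Finset.mem_filter.1 hq).2
  have hVn : ∀ q ∈ V, C.Y q < 0 := fun q hq =>
    lt_of_le_of_ne (not_lt.1 (Finset.mem_filter.1 hq).2) (hnz q (hVs hq))
  have hdisj : ∀ q ∈ U, q ∉ V := fun q hq hq' => by
    have := hUp q hq
    have := hVn q hq'
    linarith
  obtain ⟨j1, τ1, hj1, hs1, hp1⟩ := upper C U.card U rfl σ
    (hinj.mono (Finset.coe_subset.2 hUs)) hUp (fun q hq => hz q (hUs hq))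
    (fun p hp q hq hpq c hc => hgen p (hUs hp) q (hUs hq) hpq c (hUs hc))
  have off1 := steps_off hs1
  have e1 : ∀ q ∈ V, τ1 q = σ q := fun q hq => off1 q fun h => hdisj q h hq
  obtain ⟨j2, τ2, hj2, hs2, hp2⟩ := upper C.refl V.card V rfl τ1
    (by
      intro a ha b hb hab
      rw [e1 a ha, e1 b hb] at hab
      exact hinj (hVs ha) (hVs hb) hab)
    (fun q hq => by have := hVn q hq; show 0 < - C.Y q; linarith)
    (fun q hq => by rw [e1 q hq]; show - C.Y (σ q) = 0; rw [hz q (hVs hq)]; simp)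
    (fun p hp q hq hpq c hc h => by
      rw [e1 c hc] at h
      refine hgen p (hVs hp) q (hVs hq) hpq c (hVs hc) ?_
      unfold Coord.D at h ⊢
      simp only [Coord.refl] at h
      linarith)
  have off2 := steps_off hs2
  have e2 : ∀ q ∈ U, τ2 q = τ1 q := fun q hq => off2 q (hdisj q hq)
  have mono : ∀ T ⊆ R, ∀ ρ x y, FOk T ρ x y → FOk R ρ x y :=
    fun T hT ρ x y h => ⟨hT h.1, hT h.2.1, h.2.2⟩
  have hsteps := (hs1.mono (mono U hUs)).trans (hs2.mono (mono V hVs))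
  have hz2 : ∀ q ∈ R, C.Y (τ2 q) = 0 := by
    intro q hq
    obtain ⟨q', hq', e⟩ := steps_ex hsteps q hq
    rw [e]; exact hz q' hq'
  have hcases : ∀ q ∈ R, q ∈ U ∨ q ∈ V := by
    intro q hq
    by_cases h : 0 < C.Y q
    · exact Or.inl (Finset.mem_filter.2 ⟨hq, h⟩)
    · exact Or.inr (Finset.mem_filter.2 ⟨hq, h⟩)
  have hUV : ∀ p ∈ V, ∀ q ∈ U, ¬ SegCross p (τ2 p) q (τ2 q) := fun p hp q hq =>
    not_cross_of_sep C.Y C.hY (hVn p hp).le (hz2 p (hVs hp)).le (hUp q hq).le (hz2 q (hUs hq)).ge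
      (Or.inl (hVn p hp))
  refine ⟨j1 + j2, ?_, ?_⟩
  · obtain ⟨m, rfl⟩ := hn
    have hm : (m + m) / 2 = m := by omega
    rw [hm] at hcard
    have : j1 + j2 + m ≤ m * m := by
      rw [← hcard]; nlinarith
    have h' : ((j1 + j2 : ℕ) : ℝ) + m ≤ m * m := by exact_mod_cast this
    push_cast at h' ⊢
    nlinarith
  · rw [hMgr]
    refine steps_toPlane hsteps hinj ?_
    intro p hp q hq
    rcases hcases p hp with hp' | hp' <;> rcases hcases q hq with hq' | hq'
    · rw [e2 p hp', e2 q hq']; exact hp1 p hp' q hq'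
    · exact fun h => hUV q hq' p hp' (segCross_symm h)
    · exact hUV p hp' q hq'
    · exact hp2 p hp' q hq'
end
end
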